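/- Let k, l be positive integers, let λ = (k, −l) ∈ ℤ², and assume p(m) ≠ p(m+1) for every m ∈ ℤ. Then the following are equivalent: (1) p(m) > 0 for all m ∈ ℤ (equivalently, the W-orbit of λ satisfies Wλ ∩ (P⁺ ∪ −P⁺) = ∅); (2) the W-orbit of λ contains a point (k', −l') with k', l' positive integers such that l' < k' < (a−1)l' or k' < l' < (b−1)k'. -/

import Mathlib

/-- Simple reflection `r1 : (x, y) ↦ (-x, y + b x)` on the weight lattice `ℤ × ℤ`. -/
def r1 (b : ℤ) : Equiv.Perm (ℤ × ℤ) :=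
  Function.Involutive.toPerm (fun v => (-v.1, v.2 + b * v.1))
    (fun v => by simp [Prod.ext_iff])

/-- Simple reflection `r2 : (x, y) ↦ (x + a y, -y)` on the weight lattice `ℤ × ℤ`. -/
def r2 (a : ℤ) : Equiv.Perm (ℤ × ℤ) :=
  Function.Involutive.toPerm (fun v => (v.1 + a * v.2, -v.2))
    (fun v => by simp [Prod.ext_iff])

/-- The Weyl group `W`, the group of bijections of `ℤ × ℤ` generated by `r1` and `r2`. -/
def W (a b : ℤ) : Subgroup (Equiv.Perm (ℤ × ℤ)) :=
  Subgroup.closure {r1 b, r2 a}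

/-- The `W`-orbit of a point `v ∈ ℤ × ℤ`. -/
def Worbit (a b : ℤ) (v : ℤ × ℤ) : Set (ℤ × ℤ) :=
  {w : ℤ × ℤ | ∃ g ∈ W a b, g v = w}

/-- The set of dominant integral weights `P⁺`. -/
def Pplus : Set (ℤ × ℤ) := {v : ℤ × ℤ | 0 ≤ v.1 ∧ 0 ≤ v.2}

/-- The set of antidominant integral weights `-P⁺`. -/
def Pminus : Set (ℤ × ℤ) := {v : ℤ × ℤ | v.1 ≤ 0 ∧ v.2 ≤ 0}


/-- `pSeq a b k l p` says that `p : ℤ → ℤ` is the (unique) sequence with `p 0 = l`,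
`p 1 = k`, and `p (m+2) = b * p (m+1) - p m` for even `m`,
`p (m+2) = a * p (m+1) - p m` for odd `m`. -/
def pSeq (a b k l : ℤ) (p : ℤ → ℤ) : Prop :=
  p 0 = l ∧ p 1 = k ∧
    ∀ m : ℤ, p (m + 2) = (if Even m then b else a) * p (m + 1) - p m

theorem valley_up (q : ℤ → ℤ) (h : ∀ m, ∃ c : ℤ, 2 ≤ c ∧ q (m + 1) + q (m - 1) = c * q m)
    (m : ℤ) (h0 : 0 < q m) (h1 : q m < q (m + 1)) (n : ℕ) :
    0 < q (m + n) ∧ q (m + n) < q (m + n + 1) := by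
  induction n with
  | zero => simpa using ⟨h0, h1⟩
  | succ n ih =>
    obtain ⟨i1, i2⟩ := ih
    obtain ⟨c, hc, e⟩ := h (m + n + 1)
    rw [show m + (n : ℤ) + 1 - 1 = m + n by ring] at e
    rw [show m + ((n + 1 : ℕ) : ℤ) = m + n + 1 by push_cast; ring]
    refine ⟨by linarith, ?_⟩
    nlinarith

theorem valley (q : ℤ → ℤ) (h : ∀ m, ∃ c : ℤ, 2 ≤ c ∧ q (m + 1) + q (m - 1) = c * q m)
    (m : ℤ) (h0 : 0 < q m) (h1 : q m < q (m + 1)) (h2 : q m < q (m - 1)) (j : ℤ) : 0 < q j := by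
  rcases le_total m j with hj | hj
  · obtain ⟨n, hn⟩ := Int.eq_ofNat_of_zero_le (sub_nonneg.2 hj)
    have := (valley_up q h m h0 h1 n).1
    rwa [show m + (n : ℤ) = j by omega] at this
  · obtain ⟨n, hn⟩ := Int.eq_ofNat_of_zero_le (sub_nonneg.2 hj)
    have := (valley_up (fun i => q (-i)) (fun i => by
      obtain ⟨c, hc, e⟩ := h (-i)
      refine ⟨c, hc, ?_⟩
      try dsimp only
      rw [show -(i + 1) = -i - 1 by ring, show -(i - 1) = -i + 1 by ring]
      linarith) (-m) (by simpa using h0)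
      (by (try dsimp only); rw [show - -m = m by ring, show -(-m + 1) = m - 1 by ring]; exact h2) n).1
    try dsimp only at this
    rwa [show -(-m + (n : ℤ)) = j by omega] at this

theorem orbit_char (a b k l : ℤ) (p : ℤ → ℤ) (h0 : p 0 = l) (h1 : p 1 = k)
    (he : ∀ n, p (2 * n + 2) = b * p (2 * n + 1) - p (2 * n))
    (ho : ∀ n, p (2 * n + 1) = a * p (2 * n) - p (2 * n - 1)) (w : ℤ × ℤ) :
    w ∈ Worbit a b (k, -l) ↔
      ∃ n, w = (p (2 * n + 1), -p (2 * n)) ∨ w = (-p (2 * n - 1), p (2 * n)) := by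
  have e1 : ∀ n, r1 b (p (2 * n + 1), -p (2 * n)) = (-p (2 * n + 1), p (2 * n + 2)) := by
    intro n
    change ((_ : ℤ), (_ : ℤ)) = _
    rw [he n]; ext <;> dsimp only <;> ring
  have e2 : ∀ n, r2 a (p (2 * n + 1), -p (2 * n)) = (-p (2 * n - 1), p (2 * n)) := by
    intro n
    change ((_ : ℤ), (_ : ℤ)) = _
    rw [ho n]; ext <;> dsimp only <;> ring
  have i1 : ∀ v, r1 b (r1 b v) = v := fun v => by
    change (- -v.1, v.2 + b * v.1 + b * -v.1) = v
    ext <;> dsimp only <;> ring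
  have i2 : ∀ v, r2 a (r2 a v) = v := fun v => by
    change (v.1 + a * v.2 + a * -v.2, - -v.2) = v
    ext <;> dsimp only <;> ring
  have e1' : ∀ n, r1 b (-p (2 * n + 1), p (2 * n + 2)) = (p (2 * n + 1), -p (2 * n)) := by
    intro n; rw [← e1, i1]
  have e2' : ∀ n, r2 a (-p (2 * n - 1), p (2 * n)) = (p (2 * n + 1), -p (2 * n)) := by
    intro n; rw [← e2, i2]
  set S : Set (ℤ × ℤ) :=
    {w | ∃ n, w = (p (2 * n + 1), -p (2 * n)) ∨ w = (-p (2 * n - 1), p (2 * n))} with hS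
  have s1 : ∀ v ∈ S, r1 b v ∈ S := by
    rintro v ⟨n, rfl | rfl⟩
    · refine ⟨n + 1, Or.inr ?_⟩
      rw [e1, show 2 * (n + 1) - 1 = 2 * n + 1 by ring, show 2 * (n + 1) = 2 * n + 2 by ring]
    · refine ⟨n - 1, Or.inl ?_⟩
      rw [← e1', show 2 * (n - 1) + 1 = 2 * n - 1 by ring, show 2 * (n - 1) + 2 = 2 * n by ring]
  have s2 : ∀ v ∈ S, r2 a v ∈ S := by
    rintro v ⟨n, rfl | rfl⟩
    · exact ⟨n, Or.inr (e2 n)⟩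
    · exact ⟨n, Or.inl (e2' n)⟩
  change _ ↔ w ∈ S
  constructor
  · rintro ⟨g, hg, rfl⟩
    have key : ∀ v, v ∈ S ↔ g v ∈ S := by
      induction hg using Subgroup.closure_induction with
      | mem x hx =>
        rcases hx with rfl | hx
        · exact fun v => ⟨s1 v, fun h => by simpa [i1] using s1 _ h⟩
        · rw [Set.mem_singleton_iff] at hx
          subst hx
          exact fun v => ⟨s2 v, fun h => by simpa [i2] using s2 _ h⟩
      | one => simp
      | mul x y _ _ hx hy => intro v; rw [hy v, hx]; rfl
      | inv x _ hx => intro v; rw [hx (x⁻¹ v)]; simp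
    exact (key _).1 ⟨0, Or.inl (by simp [h0, h1])⟩
  · have m1 : r1 b ∈ W a b := Subgroup.subset_closure (by simp)
    have m2 : r2 a ∈ W a b := Subgroup.subset_closure (by simp)
    have o1 : ∀ v ∈ Worbit a b (k, -l), r1 b v ∈ Worbit a b (k, -l) := by
      rintro v ⟨g, hg, rfl⟩; exact ⟨_, mul_mem m1 hg, rfl⟩
    have o2 : ∀ v ∈ Worbit a b (k, -l), r2 a v ∈ Worbit a b (k, -l) := by
      rintro v ⟨g, hg, rfl⟩; exact ⟨_, mul_mem m2 hg, rfl⟩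
    have all : ∀ n, (p (2 * n + 1), -p (2 * n)) ∈ Worbit a b (k, -l) := by
      intro n
      induction n using Int.induction_on with
      | zero => exact ⟨1, one_mem _, by simp [h0, h1]⟩
      | succ n ih =>
        have := o2 _ (o1 _ ih)
        rw [e1] at this
        have e := e2' (n + 1)
        rw [show 2 * ((n : ℤ) + 1) - 1 = 2 * n + 1 by ring] at e
        rw [← e, show 2 * ((n : ℤ) + 1) = 2 * n + 2 by ring]
        exact this
      | pred n ih =>
        have := o1 _ (o2 _ ih)
        rw [e2] at this
        have e := e1' (-n - 1)
        rw [show 2 * (-(n : ℤ) - 1) + 1 = 2 * (-n) - 1 by ring,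
          show 2 * (-(n : ℤ) - 1) + 2 = 2 * (-n) by ring] at e
        rw [show 2 * (-(n : ℤ) - 1) + 1 = 2 * (-n) - 1 by ring, ← e]
        exact this
    rintro ⟨n, rfl | rfl⟩
    · exact all n
    · rw [← e2]; exact o2 _ (all n)

theorem orbit_tfae (a b : ℤ) (ha : 2 ≤ a) (hb : 2 ≤ b) (hab : 4 < a * b)
    (k l : ℤ) (hk : 0 < k) (hl : 0 < l)
    (p : ℤ → ℤ) (hp : pSeq a b k l p) (hne : ∀ m : ℤ, p m ≠ p (m + 1)) :
    ((∀ m : ℤ, 0 < p m) ↔ Worbit a b (k, -l) ∩ (Pplus ∪ Pminus) = ∅) ∧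
    ((∀ m : ℤ, 0 < p m) ↔
      ∃ k' l' : ℤ, 0 < k' ∧ 0 < l' ∧
        ((l' < k' ∧ k' < (a - 1) * l') ∨ (k' < l' ∧ l' < (b - 1) * k')) ∧
        (k', -l') ∈ Worbit a b (k, -l)) := by
  obtain ⟨h0, h1, hr⟩ := hp
  have he : ∀ n, p (2 * n + 2) = b * p (2 * n + 1) - p (2 * n) := by
    intro n
    have := hr (2 * n)
    rwa [if_pos (even_two_mul n)] at this
  have ho : ∀ n, p (2 * n + 1) = a * p (2 * n) - p (2 * n - 1) := by
    intro n
    have := hr (2 * n - 1)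
    rw [if_neg (by rw [Int.not_even_iff_odd]; exact ⟨n - 1, by ring⟩)] at this
    rwa [show 2 * n - 1 + 2 = 2 * n + 1 by ring, show 2 * n - 1 + 1 = 2 * n by ring] at this
  have hc := orbit_char a b k l p h0 h1 he ho
  have hrec : ∀ m, ∃ c : ℤ, 2 ≤ c ∧ p (m + 1) + p (m - 1) = c * p m := by
    intro m
    have := hr (m - 1)
    rw [show m - 1 + 2 = m + 1 by ring, show m - 1 + 1 = m by ring] at this
    refine ⟨if Even (m - 1) then b else a, by split_ifs <;> assumption, by linarith⟩
  have hrec' : ∀ m, ∃ c : ℤ, 2 ≤ c ∧ (fun i => -p i) (m + 1) + (fun i => -p i) (m - 1)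
      = c * (fun i => -p i) m := by
    intro m
    obtain ⟨c, h, e⟩ := hrec m
    exact ⟨c, h, by (try dsimp only); linarith⟩
  refine ⟨⟨?_, ?_⟩, ?_, ?_⟩
  · intro hpos
    rw [Set.eq_empty_iff_forall_notMem]
    rintro w ⟨hw, hP⟩
    obtain ⟨n, rfl | rfl⟩ := (hc w).1 hw
    · have := hpos (2 * n + 1)
      have := hpos (2 * n)
      rcases hP with ⟨x, y⟩ | ⟨x, y⟩ <;> dsimp only at x y <;> linarith
    · have := hpos (2 * n - 1)
      have := hpos (2 * n)
      rcases hP with ⟨x, y⟩ | ⟨x, y⟩ <;> dsimp only at x y <;> linarith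
  · intro hE
    rw [Set.eq_empty_iff_forall_notMem] at hE
    have hs : ∀ m, 0 < p m ↔ 0 < p (m + 1) := by
      intro m
      obtain ⟨n, hn | hn⟩ := Int.even_or_odd' m
      · have := fun h => hE (p (2 * n + 1), -p (2 * n)) ⟨(hc _).2 ⟨n, Or.inl rfl⟩, h⟩
        replace this := not_or.1 this
        have t1 : ¬ (0 ≤ p (2 * n + 1) ∧ 0 ≤ -p (2 * n)) := this.1
        have t2 : ¬ (p (2 * n + 1) ≤ 0 ∧ -p (2 * n) ≤ 0) := this.2
        rw [hn]; omega
      · have := fun h => hE (-p (2 * (n + 1) - 1), p (2 * (n + 1)))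
          ⟨(hc _).2 ⟨n + 1, Or.inr rfl⟩, h⟩
        replace this := not_or.1 this
        rw [show 2 * (n + 1) - 1 = m by omega, show 2 * (n + 1) = m + 1 by omega] at this
        have t1 : ¬ (0 ≤ -p m ∧ 0 ≤ p (m + 1)) := this.1
        have t2 : ¬ (-p m ≤ 0 ∧ p (m + 1) ≤ 0) := this.2
        omega
    intro m
    induction m using Int.induction_on with
    | zero => rw [h0]; exact hl
    | succ n ih => exact (hs _).1 ih
    | pred n ih => rw [hs]; simpa using ih
  · intro hpos
    obtain ⟨m, hm⟩ : ∃ m, ∀ j, p m ≤ p j := by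
      have hm := fun j => Function.argmin_le (fun m : ℤ => (p m).toNat) j
      generalize Function.argmin (fun m : ℤ => (p m).toNat) = m at hm
      refine ⟨m, fun j => ?_⟩
      have := hm j
      have := hpos m
      have := hpos j
      omega
    have q1 := lt_of_le_of_ne (hm (m + 1)) (hne m)
    have q2 : p m < p (m - 1) := lt_of_le_of_ne (hm (m - 1)) (fun e => hne (m - 1) (by
      rw [sub_add_cancel]; exact e.symm))
    obtain ⟨n, hn | hn⟩ := Int.even_or_odd' m
    · subst hn
      refine ⟨p (2 * n + 1), p (2 * n), hpos _, hpos _, Or.inl ⟨q1, ?_⟩, (hc _).2 ⟨n, Or.inl rfl⟩⟩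
      linarith [ho n]
    · subst hn
      rw [add_sub_cancel_right] at q2
      rw [show 2 * n + 1 + 1 = 2 * n + 2 by ring] at q1
      refine ⟨p (2 * n + 1), p (2 * n), hpos _, hpos _, Or.inr ⟨q2, ?_⟩, (hc _).2 ⟨n, Or.inl rfl⟩⟩
      linarith [he n]
  · rintro ⟨k', l', hk', hl', hkl, hw⟩
    obtain ⟨n, hn | hn⟩ := (hc _).1 hw
    · obtain ⟨rfl, hn2⟩ := Prod.mk.inj hn
      obtain rfl : l' = p (2 * n) := by linarith
      rcases hkl with ⟨u, v⟩ | ⟨u, v⟩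
      · exact valley p hrec (2 * n) hl' u (by linarith [ho n])
      · refine valley p hrec (2 * n + 1) hk' ?_ ?_
        · rw [show 2 * n + 1 + 1 = 2 * n + 2 by ring]; linarith [he n]
        · rwa [add_sub_cancel_right]
    · exfalso
      obtain ⟨rfl, hn2⟩ := Prod.mk.inj hn
      obtain rfl : l' = -p (2 * n) := by linarith
      have e := he (n - 1)
      rw [show 2 * (n - 1) + 2 = 2 * n by ring, show 2 * (n - 1) + 1 = 2 * n - 1 by ring,
        show 2 * (n - 1) = 2 * n - 1 - 1 by ring] at e
      have : 0 < -p 0 := by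
        rcases hkl with ⟨u, v⟩ | ⟨u, v⟩
        · exact valley (fun i => -p i) hrec' (2 * n) hl' (by (try dsimp only); linarith [ho n]) u 0
        · refine valley (fun i => -p i) hrec' (2 * n - 1) hk' ?_ ?_ 0
          · (try dsimp only); rwa [sub_add_cancel]
          · (try dsimp only); linarith
      linarith
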